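/- Structure of hybrid extended codewords across one BRGC up-count: let I = ⟨i,i+p⟩ ⊆ {0,...,2^n(k+1)-1} with p ≤ k, and suppose there is j ∈ ⟨i+1,i+p⟩ that is a multiple of k+1. Then the extended codeword x_I = ⊛γ^h_{n,k}(I) satisfies (x_I)_g = γ^h_{n,k}(i)_g * γ^h_{n,k}(j)_g, which has exactly one position equal to M, and (x_I)_u = M^β b^{k-α-β} M^α, where b = ¬parity(γ^h_{n,k}(i)_g), α = j - 1 - i, and β = i + p - j. Moreover, if p ≤ ⌈k/2⌉ then α ≤ ⌈k/2⌉, β ≤ ⌈k/2⌉, and the bit of (x_I)_u at position ⌈k/2⌉ equals b. -/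

import Mathlib

/-- Resolution of a ternary word (`none` is the metastable value `M`). -/
def res {n : ℕ} (x : Fin n → Option Bool) : Set (Fin n → Bool) :=
  {y | ∀ j : Fin n, ∀ b : Bool, x j = some b → y j = b}

open Classical in
/-- Extended codeword: pointwise superposition of all codewords `γ a`, `a ∈ I`. -/
noncomputable def extCW {M n : ℕ} (γ : Fin M → Fin n → Bool) (I : Set (Fin M)) :
    Fin n → Option Bool :=
  fun j =>
    if ∀ a ∈ I, γ a j = true then some true
    else if ∀ a ∈ I, γ a j = false then some false
    else none

/-- The interval `⟨i, i+p⟩ = {i, ..., i+p}` inside `{0, ..., M-1}`. -/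
def intvl (M i p : ℕ) : Set (Fin M) := {a : Fin M | i ≤ a.val ∧ a.val ≤ i + p}

/-- Binary superposition of two Boolean words. -/
def sup2 {n : ℕ} (x y : Fin n → Bool) : Fin n → Option Bool :=
  fun j => if x j = y j then some (x j) else none

/-- The binary reflected Gray code, position `0` is the most significant bit. -/
def brgc : (n : ℕ) → Fin (2^n) → Fin n → Bool
  | 0 => fun _ => fun i => i.elim0
  | n+1 => fun i =>
      if h : i.val < 2^n then Fin.cons false (brgc n ⟨i.val, h⟩)
      else Fin.cons true (brgc n ⟨2^(n+1) - i.val - 1, by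
        have h1 := i.isLt
        have h2 : (2:ℕ)^(n+1) = 2^n * 2 := pow_succ 2 n
        omega⟩)

/-- Unary thermometer codeword `1^m 0^(k-m)`. -/
def unary (k m : ℕ) : Fin k → Bool := fun j => decide (j.val < m)

/-- Unary thermometer codeword `0^m 1^(k-m)`. -/
def unaryBar (k m : ℕ) : Fin k → Bool := fun j => decide (m ≤ j.val)

/-- Parity of a Boolean word: `true` iff the number of `1`s is odd. -/
def parityW {m : ℕ} (x : Fin m → Bool) : Bool :=
  decide ((Finset.univ.filter (fun i : Fin m => x i = true)).card % 2 = 1)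

/-- The hybrid code `γ^h_{n,k}`: an `n`-bit BRGC part followed by a `k`-bit
unary part whose flavor is selected by the parity of the BRGC part. -/
def hybrid (n k : ℕ) : Fin (2^n * (k+1)) → Fin (n + k) → Bool :=
  fun i =>
    let xg : Fin n → Bool := brgc n ⟨i.val / (k+1), Nat.div_lt_of_lt_mul (mul_comm (2^n) (k+1) ▸ i.isLt)⟩
    let xu : Fin k → Bool :=
      if parityW xg = false then unary k (i.val % (k+1)) else unaryBar k (i.val % (k+1))
    Fin.append xg xu

/-- The BRGC part (first `n` bits) of an `(n+k)`-bit word. -/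
def gpart {n k : ℕ} (x : Fin (n+k) → Bool) : Fin n → Bool := fun j => x (Fin.castAdd k j)

/-- The unary part (last `k` bits) of an `(n+k)`-bit word. -/
def upart {n k : ℕ} (x : Fin (n+k) → Bool) : Fin k → Bool := fun j => x (Fin.natAdd n j)

theorem extCW_eq_some {M n : ℕ} {γ : Fin M → Fin n → Bool} {I : Set (Fin M)} {t : Fin n}
    {b : Bool} (hI : I.Nonempty) (h : ∀ a ∈ I, γ a t = b) : extCW γ I t = some b := by
  obtain ⟨x, hx⟩ := hI
  unfold extCW
  cases b with
  | true => rw [if_pos h]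
  | false =>
    rw [if_neg, if_pos h]
    intro h'
    simpa [h x hx] using h' x hx

theorem extCW_eq_none {M n : ℕ} {γ : Fin M → Fin n → Bool} {I : Set (Fin M)} {t : Fin n}
    {a a' : Fin M} (ha : a ∈ I) (ha' : a' ∈ I) (h : γ a t ≠ γ a' t) : extCW γ I t = none := by
  unfold extCW
  rw [if_neg fun h' => h ((h' a ha).trans (h' a' ha').symm),
    if_neg fun h' => h ((h' a ha).trans (h' a' ha').symm)]

theorem parityW_cons_false {n : ℕ} (x : Fin n → Bool) :
    parityW (Fin.cons false x : Fin (n + 1) → Bool) = parityW x := by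
  simp [parityW, Fin.card_filter_univ_succ]

theorem parityW_cons_true {n : ℕ} (x : Fin n → Bool) :
    parityW (Fin.cons true x : Fin (n + 1) → Bool) = !parityW x := by
  simp only [parityW, Fin.card_filter_univ_succ, Fin.cons_zero, Fin.cons_succ, if_true]
  rw [← decide_not, decide_eq_decide]
  omega

theorem parityW_brgc (n : ℕ) (i : Fin (2 ^ n)) :
    parityW (brgc n i) = decide (i.val % 2 = 1) := by
  induction n with
  | zero =>
    simp [parityW]
  | succ n ih =>
    have hi := i.isLt
    have h2 : (2 : ℕ) ^ (n + 1) = 2 ^ n * 2 := pow_succ 2 n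
    simp only [brgc]
    split_ifs with h
    · rw [parityW_cons_false, ih]
    · rw [parityW_cons_true, ih, ← decide_not, decide_eq_decide]
      dsimp only
      omega

/-- Consecutive Gray codewords differ in exactly one position. -/
theorem existsUnique_brgc_ne (n c : ℕ) (h : c + 1 < 2 ^ n) :
    ∃! t : Fin n, brgc n ⟨c, by omega⟩ t ≠ brgc n ⟨c + 1, h⟩ t := by
  induction n generalizing c with
  | zero => simp at h
  | succ n ih =>
    have h2 : (2 : ℕ) ^ (n + 1) = 2 ^ n * 2 := pow_succ 2 n
    have lift : ∀ (b : Bool) (x y : Fin n → Bool), (∃! t, x t ≠ y t) →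
        ∃! t, (Fin.cons b x : Fin (n + 1) → Bool) t ≠ (Fin.cons b y : Fin (n + 1) → Bool) t := by
      rintro b x y ⟨t, ht, hu⟩
      refine ⟨t.succ, by simpa using ht, fun s => ?_⟩
      refine Fin.cases (by simp) (fun s hs => ?_) s
      exact congrArg Fin.succ (hu s (by simpa using hs))
    simp only [brgc]
    rcases lt_trichotomy (c + 1) (2 ^ n) with hc | hc | hc
    · rw [dif_pos (by omega), dif_pos hc]
      exact lift _ _ _ (ih c hc)
    · rw [dif_pos (by omega), dif_neg (by omega)]
      have e : 2 ^ (n + 1) - (c + 1) - 1 = c := by omega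
      simp only [e]
      refine ⟨0, by simp, fun s => ?_⟩
      exact Fin.cases (by simp) (fun s hs => by simp at hs) s
    · rw [dif_neg (by omega), dif_neg (by omega)]
      apply lift
      have e : 2 ^ (n + 1) - c - 1 = 2 ^ (n + 1) - (c + 1) - 1 + 1 := by omega
      simp only [e, ne_comm (a := brgc n ⟨_ + 1, _⟩ _)]
      exact ih _ _

theorem hybrid_castAdd {n k : ℕ} (a : Fin (2 ^ n * (k + 1))) {c : ℕ} (hc : c < 2 ^ n)
    (ha : a.val / (k + 1) = c) (t : Fin n) :
    hybrid n k a (Fin.castAdd k t) = brgc n ⟨c, hc⟩ t := by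
  subst ha
  simp [hybrid]

theorem hybrid_natAdd {n k : ℕ} (a : Fin (2 ^ n * (k + 1))) (t : Fin k) :
    hybrid n k a (Fin.natAdd n t) =
      if a.val / (k + 1) % 2 = 1 then decide (a.val % (k + 1) ≤ t.val)
      else decide (t.val < a.val % (k + 1)) := by
  simp only [hybrid, Fin.append_right, parityW_brgc, decide_eq_false_iff_not]
  split_ifs <;> rfl

/-- Structure of hybrid extended codewords across one BRGC up-count:
if some `j ∈ ⟨i+1, i+p⟩` is a multiple of `k+1`, then the BRGC part of the
extended codeword is the superposition of the BRGC parts of the codewords of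
`i` and `j` (with exactly one metastable position), and the unary part is
`M^β b^(k-α-β) M^α` with `b = ¬parity(γ^h(i)_g)`, `α = j-1-i`, `β = i+p-j`.
Moreover if `p ≤ ⌈k/2⌉` then `α, β ≤ ⌈k/2⌉` and the unary bit at (1-indexed)
position `⌈k/2⌉` is `b`. -/
theorem hybrid_ext_two_columns (n k : ℕ) (hk : 1 ≤ k) (hnk : k ≤ n)
    (i j : Fin (2^n * (k+1))) (p : ℕ)
    (hp : p ≤ k) (hip : i.val + p < 2^n * (k+1))
    (hj1 : i.val + 1 ≤ j.val) (hj2 : j.val ≤ i.val + p) (hjd : (k+1) ∣ j.val) :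
    (∀ t : Fin n,
      extCW (hybrid n k) (intvl (2^n * (k+1)) i.val p) (Fin.castAdd k t) =
        sup2 (gpart (hybrid n k i)) (gpart (hybrid n k j)) t) ∧
    Set.ncard {t : Fin n |
      extCW (hybrid n k) (intvl (2^n * (k+1)) i.val p) (Fin.castAdd k t) = none} = 1 ∧
    (∀ t : Fin k,
      extCW (hybrid n k) (intvl (2^n * (k+1)) i.val p) (Fin.natAdd n t) =
        if t.val < i.val + p - j.val then none
        else if t.val < k - (j.val - 1 - i.val) then
          some (!parityW (gpart (hybrid n k i)))
        else none) ∧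
    (p ≤ (k+1)/2 →
      j.val - 1 - i.val ≤ (k+1)/2 ∧ i.val + p - j.val ≤ (k+1)/2 ∧
      extCW (hybrid n k) (intvl (2^n * (k+1)) i.val p)
          (Fin.natAdd n ⟨(k-1)/2, by omega⟩) =
        some (!parityW (gpart (hybrid n k i)))) := by
  obtain ⟨c, hc⟩ := hjd
  obtain ⟨d, rfl⟩ : ∃ d, c = d + 1 := ⟨c - 1, by cases c <;> omega⟩
  rw [Nat.mul_succ (k + 1) d] at hc
  have hcol (a : ℕ) (h1 : i.val ≤ a) (h2 : a < j.val) :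
      a / (k + 1) = d ∧ a % (k + 1) = a - (k + 1) * d := by
    have ea : a = (a - (k + 1) * d) + (k + 1) * d := by omega
    have hlt : a - (k + 1) * d < k + 1 := by omega
    constructor
    · rw [ea, Nat.add_mul_div_left _ _ (Nat.succ_pos k), Nat.div_eq_of_lt hlt, zero_add]
    · conv_lhs => rw [ea, Nat.add_mul_mod_self_left, Nat.mod_eq_of_lt hlt]
  have hcol' (a : ℕ) (h1 : j.val ≤ a) (h2 : a ≤ i.val + p) :
      a / (k + 1) = d + 1 ∧ a % (k + 1) = a - j.val := by
    have ea : a = (a - j.val) + (k + 1) * (d + 1) := by rw [Nat.mul_succ (k + 1) d]; omega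
    have hlt : a - j.val < k + 1 := by omega
    constructor
    · rw [ea, Nat.add_mul_div_left _ _ (Nat.succ_pos k), Nat.div_eq_of_lt hlt, zero_add]
    · conv_lhs => rw [ea, Nat.add_mul_mod_self_left, Nat.mod_eq_of_lt hlt]
  have hd : d + 1 < 2 ^ n := by
    rw [← (hcol' j.val le_rfl hj2).1]
    exact Nat.div_lt_of_lt_mul (mul_comm (2 ^ n) (k + 1) ▸ j.isLt)
  have hiI : i ∈ intvl (2 ^ n * (k + 1)) i.val p := ⟨le_rfl, by omega⟩
  have hjI : j ∈ intvl (2 ^ n * (k + 1)) i.val p := ⟨by omega, hj2⟩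
  have hgi (t : Fin n) := hybrid_castAdd i (by omega) (hcol i.val le_rfl hj1).1 t
  have hgj (t : Fin n) := hybrid_castAdd j hd (hcol' j.val le_rfl hj2).1 t
  have hpar : (!parityW (gpart (hybrid n k i))) = decide (d % 2 = 0) := by
    rw [show gpart (hybrid n k i) = brgc n ⟨d, by omega⟩ from funext hgi, parityW_brgc,
      ← decide_not, decide_eq_decide]
    dsimp only
    omega
  have hG (t : Fin n) : extCW (hybrid n k) (intvl (2 ^ n * (k + 1)) i.val p) (Fin.castAdd k t) =
      sup2 (gpart (hybrid n k i)) (gpart (hybrid n k j)) t := by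
    unfold sup2
    split_ifs with h
    · refine extCW_eq_some ⟨i, hiI⟩ fun a ha => ?_
      rcases lt_or_ge a.val j.val with hlt | hge
      · exact (hybrid_castAdd a (by omega) (hcol a.val ha.1 hlt).1 t).trans (hgi t).symm
      · exact ((hybrid_castAdd a hd (hcol' a.val hge ha.2).1 t).trans (hgj t).symm).trans h.symm
    · exact extCW_eq_none hiI hjI h
  have hu (a : Fin (2 ^ n * (k + 1))) (h1 : i.val ≤ a.val) (h2 : a.val < j.val) (t : Fin k) :
      hybrid n k a (Fin.natAdd n t) =
        (decide (d % 2 = 0) == decide (t.val < a.val - (k + 1) * d)) := by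
    rw [hybrid_natAdd, (hcol a.val h1 h2).1, (hcol a.val h1 h2).2]
    grind
  have hu' (a : Fin (2 ^ n * (k + 1))) (h1 : j.val ≤ a.val) (h2 : a.val ≤ i.val + p)
      (t : Fin k) : hybrid n k a (Fin.natAdd n t) =
        (decide (d % 2 = 0) == decide (a.val - j.val ≤ t.val)) := by
    rw [hybrid_natAdd, (hcol' a.val h1 h2).1, (hcol' a.val h1 h2).2]
    grind
  have hU (t : Fin k) : extCW (hybrid n k) (intvl (2 ^ n * (k + 1)) i.val p) (Fin.natAdd n t) =
      if t.val < i.val + p - j.val then none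
      else if t.val < k - (j.val - 1 - i.val) then some (!parityW (gpart (hybrid n k i)))
      else none := by
    have ht := t.isLt
    split_ifs with h1 h2
    · refine extCW_eq_none (a := j) (a' := ⟨i.val + p, hip⟩) hjI ⟨by simp, le_rfl⟩ ?_
      rw [hu' _ le_rfl hj2, hu' _ hj2 le_rfl]
      grind
    · rw [hpar]
      refine extCW_eq_some ⟨i, hiI⟩ fun a ha => ?_
      have ha1 : i.val ≤ a.val := ha.1
      have ha2 : a.val ≤ i.val + p := ha.2
      rcases lt_or_ge a.val j.val with hlt | hge
      · rw [hu a ha1 hlt, decide_eq_true (p := t.val < _) (by omega), beq_true]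
      · rw [hu' a hge ha2, decide_eq_true (p := _ ≤ t.val) (by omega), beq_true]
    · refine extCW_eq_none hiI hjI ?_
      rw [hu i le_rfl hj1, hu' j le_rfl hj2, decide_eq_false (p := t.val < _) (by omega),
        decide_eq_true (p := _ ≤ t.val) (by omega)]
      simp
  refine ⟨hG, ?_, hU, fun hpk => ⟨by omega, by omega, ?_⟩⟩
  · obtain ⟨t, ht, hunique⟩ := existsUnique_brgc_ne n d hd
    have hnone (s : Fin n) :
        extCW (hybrid n k) (intvl (2 ^ n * (k + 1)) i.val p) (Fin.castAdd k s) = none ↔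
          brgc n ⟨d, by omega⟩ s ≠ brgc n ⟨d + 1, hd⟩ s := by
      rw [hG, ← hgi, ← hgj]
      unfold sup2 gpart
      split_ifs with h <;> simp [h]
    rw [Set.ncard_eq_one]
    refine ⟨t, Set.ext fun s => ?_⟩
    rw [Set.mem_ofPred_eq, hnone, Set.mem_singleton_iff]
    exact ⟨hunique s, fun h => h ▸ ht⟩
  · rw [hU, if_neg (by dsimp only; omega), if_pos (by dsimp only; omega)]
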